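/- arXiv:math/0701441 — 2 statements merged into one kernel-verified Lean document; each statement's English description precedes it below -/
import Mathlib

section
/- For every group G, the group H(G) is isomorphic to the semidirect product (G * ℤ) ⋊ G, where the G-action on the free product G * ⟨t⟩ is given by letting g ∈ G act as the automorphism that fixes every element of the factor G and sends t ↦ t g⁻¹. -/
/-!
STATEMENT 5: For every group `G`, the Formanek–Procesi group `H(G)` is isomorphic
to the semidirect product `(G * ℤ) ⋊ G`, where the `G`-action on the free product
`G * ⟨t⟩` is given by letting `g ∈ G` act as the automorphism `s_g` fixing every
element of the factor `G` and sending `t ↦ t g⁻¹`.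

Note: `g ↦ s_g` is a right action (`s_g ∘ s_h = s_{hg}`); in Mathlib's
`SemidirectProduct`, which uses left actions, the corresponding action
homomorphism is `φ : g ↦ s_{g⁻¹}`.
-/
variable (G : Type*) [Group G]

/-- The diagonal subgroup `{(g,g)} ≤ G × G`. -/
def diagSubgroup : Subgroup (G × G) where
  carrier := {p | p.1 = p.2}
  one_mem' := rfl
  mul_mem' := by
    intro a b (ha : a.1 = a.2) (hb : b.1 = b.2)
    show a.1 * b.1 = a.2 * b.2
    rw [ha, hb]
  inv_mem' := by
    intro a (ha : a.1 = a.2)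
    show a.1⁻¹ = a.2⁻¹
    rw [ha]

/-- The subgroup `G × {1} ≤ G × G`. -/
def leftSubgroup : Subgroup (G × G) where
  carrier := {p | p.2 = 1}
  one_mem' := rfl
  mul_mem' := by
    intro a b (ha : a.2 = 1) (hb : b.2 = 1)
    show a.2 * b.2 = 1
    rw [ha, hb, mul_one]
  inv_mem' := by
    intro a (ha : a.2 = 1)
    show a.2⁻¹ = 1
    rw [ha, inv_one]

/-- The isomorphism `(g,g) ↦ (g,1)` from the diagonal onto `G × {1}`. -/
def diagToLeft : diagSubgroup G ≃* leftSubgroup G where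
  toFun x := ⟨(x.1.1, 1), rfl⟩
  invFun x := ⟨(x.1.1, x.1.1), rfl⟩
  left_inv := by
    rintro ⟨⟨a, b⟩, (h : a = b)⟩
    subst h
    rfl
  right_inv := by
    rintro ⟨⟨a, b⟩, (h : b = 1)⟩
    subst h
    rfl
  map_mul' x y := by
    apply Subtype.ext
    show ((x*y).1.1, (1:G)) = (x.1.1 * y.1.1, 1*1)
    rw [mul_one]
    rfl

/-- The Formanek–Procesi group `H(G)`: the HNN extension of `G × G` with stable
letter `t` and the relations `t (g,g) t⁻¹ = (g,1)`. -/
def FPGroup : Type _ := HNNExtension (G × G) (diagSubgroup G) (leftSubgroup G) (diagToLeft G)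

instance : Group (FPGroup G) := by delta FPGroup; infer_instance

/-- The free product `G * ℤ`, with `ℤ = ⟨t⟩` the free group on one generator. -/
abbrev FreeProdZ : Type _ := Monoid.Coprod G (FreeGroup Unit)

/-- The generator `t` of the infinite cyclic free factor of `G * ⟨t⟩`. -/
def tGen : FreeProdZ G := Monoid.Coprod.inr (FreeGroup.of ())

variable {G}

/-- The endomorphism of `G * ⟨t⟩` fixing `G` and sending `t ↦ t g⁻¹`. -/
def sEnd (g : G) : FreeProdZ G →* FreeProdZ G :=
  Monoid.Coprod.lift Monoid.Coprod.inl
    (FreeGroup.lift fun _ => tGen G * Monoid.Coprod.inl g⁻¹)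

lemma sEnd_comp_sEnd (g h : G) : (sEnd g).comp (sEnd h) = sEnd (h * g) := by
  apply Monoid.Coprod.hom_ext
  · ext x
    simp [sEnd, tGen]
  · apply FreeGroup.ext_hom
    intro a
    simp [sEnd, tGen, mul_assoc]

lemma sEnd_one : sEnd (1 : G) = MonoidHom.id (FreeProdZ G) := by
  apply Monoid.Coprod.hom_ext
  · ext x
    simp [sEnd, tGen]
  · apply FreeGroup.ext_hom
    intro a
    cases a
    simp [sEnd, tGen]

/-- The automorphism `s_g` of `G * ⟨t⟩` fixing every element of `G` and sending
`t ↦ t g⁻¹`. -/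
def sAut (g : G) : MulAut (FreeProdZ G) where
  toFun := sEnd g
  invFun := sEnd g⁻¹
  left_inv x := by
    have : (sEnd g⁻¹).comp (sEnd g) = MonoidHom.id _ := by
      rw [sEnd_comp_sEnd, mul_inv_cancel, sEnd_one]
    exact DFunLike.congr_fun this x
  right_inv x := by
    have : (sEnd g).comp (sEnd g⁻¹) = MonoidHom.id _ := by
      rw [sEnd_comp_sEnd, inv_mul_cancel, sEnd_one]
    exact DFunLike.congr_fun this x
  map_mul' := map_mul (sEnd g)


@[simp]
lemma sAut_inl (g x : G) : sAut g (Monoid.Coprod.inl x) = Monoid.Coprod.inl x :=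
  rfl

@[simp]
lemma sAut_tGen (g : G) : sAut g (tGen G) = tGen G * Monoid.Coprod.inl g⁻¹ := by
  change sEnd g (tGen G) = _
  simp [sEnd, tGen]

variable (G) in
/-- The left action of `G` on `G * ⟨t⟩` by `g ↦ s_{g⁻¹}`. -/
def sHom : G →* MulAut (FreeProdZ G) where
  toFun g := sAut g⁻¹
  map_one' := by
    ext x
    change sEnd (1 : G)⁻¹ x = x
    simp [sEnd_one]
  map_mul' g h := by
    ext x
    change sEnd (g * h)⁻¹ x = (sEnd g⁻¹).comp (sEnd h⁻¹) x
    rw [sEnd_comp_sEnd, mul_inv_rev]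

lemma sHom_apply (g : G) : sHom G g = sAut g⁻¹ := rfl

namespace FPGroup

variable (G) in
/-- The canonical map `G × G → H(G)`. -/
def of : G × G →* FPGroup G := HNNExtension.of

variable (G) in
/-- The stable letter of `H(G)`. -/
def t : FPGroup G := HNNExtension.t

lemma t_mul_of_diag (g : G) : t G * of G (g, g) = of G (g, 1) * t G :=
  HNNExtension.t_mul_of (φ := diagToLeft G) ⟨(g, g), rfl⟩

lemma hom_ext {M : Type*} [Monoid M] {f₁ f₂ : FPGroup G →* M}
    (h : f₁.comp (of G) = f₂.comp (of G)) (ht : f₁ (t G) = f₂ (t G)) : f₁ = f₂ :=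
  HNNExtension.hom_ext h ht

/-- The universal property of `H(G)`. -/
def lift {K : Type*} [Group K] (f : G × G →* K) (x : K)
    (hx : ∀ g, x * f (g, g) = f (g, 1) * x) : FPGroup G →* K :=
  HNNExtension.lift f x <| by
    rintro ⟨⟨a, b⟩, h : a = b⟩
    subst h
    exact hx a

@[simp]
lemma lift_of {K : Type*} [Group K] (f : G × G →* K) (x : K)
    (hx : ∀ g, x * f (g, g) = f (g, 1) * x) (p : G × G) : lift f x hx (of G p) = f p :=
  HNNExtension.lift_of _ _ _ p

@[simp]
lemma lift_t {K : Type*} [Group K] (f : G × G →* K) (x : K)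
    (hx : ∀ g, x * f (g, g) = f (g, 1) * x) : lift f x hx (t G) = x :=
  HNNExtension.lift_t _ _ _

variable (G) in
/-- The map `(a, b) ↦ (b, a)` from `G × G` to `(G * ⟨t⟩) ⋊ G`. -/
def prodToSemidirect : G × G →* SemidirectProduct (FreeProdZ G) G (sHom G) where
  toFun p := ⟨Monoid.Coprod.inl p.2, p.1⟩
  map_one' := by ext <;> simp
  map_mul' p q := by ext <;> simp [sHom_apply]

variable (G) in
/-- The map `H(G) → (G * ⟨t⟩) ⋊ G` sending `(a, b) ↦ (b, a)` and `t ↦ (t, 1)`. -/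
def toSemidirect : FPGroup G →* SemidirectProduct (FreeProdZ G) G (sHom G) :=
  lift (prodToSemidirect G) (SemidirectProduct.inl (tGen G)) fun g => by
    ext <;> simp [prodToSemidirect, sHom_apply]

@[simp]
lemma toSemidirect_of (p : G × G) :
    toSemidirect G (of G p) = ⟨Monoid.Coprod.inl p.2, p.1⟩ :=
  lift_of _ _ _ p

@[simp]
lemma toSemidirect_t : toSemidirect G (t G) = SemidirectProduct.inl (tGen G) :=
  lift_t _ _ _

variable (G) in
/-- The map `G * ⟨t⟩ → H(G)` sending `g ↦ (1, g)` and `t ↦ t`. -/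
def ofFreeProd : FreeProdZ G →* FPGroup G :=
  Monoid.Coprod.lift ((of G).comp (MonoidHom.inr G G)) (FreeGroup.lift fun _ => t G)

@[simp]
lemma ofFreeProd_inl (g : G) : ofFreeProd G (Monoid.Coprod.inl g) = of G (1, g) := rfl

@[simp]
lemma ofFreeProd_tGen : ofFreeProd G (tGen G) = t G := by
  simp [ofFreeProd, tGen]

lemma ofFreeProd_comp_sHom (g : G) :
    (ofFreeProd G).comp (sHom G g).toMonoidHom =
      (MulAut.conj (of G (g, 1))).toMonoidHom.comp (ofFreeProd G) := by
  apply Monoid.Coprod.hom_ext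
  · ext x
    simp [sHom_apply, ← map_mul, ← map_inv]
  · apply FreeGroup.ext_hom
    rintro ⟨⟩
    change ofFreeProd G (sAut g⁻¹ (tGen G)) = of G (g, 1) * ofFreeProd G (tGen G) * (of G (g, 1))⁻¹
    rw [sAut_tGen, map_mul, ofFreeProd_tGen, ofFreeProd_inl, ← t_mul_of_diag, mul_assoc,
      ← map_inv, ← map_mul]
    simp

variable (G) in
/-- The map `(G * ⟨t⟩) ⋊ G → H(G)` inverse to `toSemidirect`. -/
def ofSemidirect : SemidirectProduct (FreeProdZ G) G (sHom G) →* FPGroup G :=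
  SemidirectProduct.lift (ofFreeProd G) ((of G).comp (MonoidHom.inl G G)) ofFreeProd_comp_sHom

@[simp]
lemma ofSemidirect_inl (x : FreeProdZ G) :
    ofSemidirect G (SemidirectProduct.inl x) = ofFreeProd G x :=
  SemidirectProduct.lift_inl _ _ _ x

@[simp]
lemma ofSemidirect_inr (g : G) :
    ofSemidirect G (SemidirectProduct.inr g) = of G (g, 1) :=
  SemidirectProduct.lift_inr _ _ _ g

lemma ofSemidirect_comp_toSemidirect :
    (ofSemidirect G).comp (toSemidirect G) = MonoidHom.id (FPGroup G) := by
  apply hom_ext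
  · refine MonoidHom.ext fun p => ?_
    simp [SemidirectProduct.mk_eq_inl_mul_inr, ← map_mul (of G)]
  · simp

lemma toSemidirect_comp_ofSemidirect :
    (toSemidirect G).comp (ofSemidirect G) = MonoidHom.id _ := by
  apply SemidirectProduct.hom_ext
  · apply Monoid.Coprod.hom_ext
    · refine MonoidHom.ext fun g => ?_
      ext <;> simp
    · apply FreeGroup.ext_hom
      rintro ⟨⟩
      change toSemidirect G (ofSemidirect G (SemidirectProduct.inl (tGen G))) =
        SemidirectProduct.inl (tGen G)
      simp
  · refine MonoidHom.ext fun g => ?_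
    ext <;> simp

variable (G) in
/-- The isomorphism `H(G) ≃ (G * ⟨t⟩) ⋊ G`. -/
def equivSemidirect : FPGroup G ≃* SemidirectProduct (FreeProdZ G) G (sHom G) :=
  (toSemidirect G).toMulEquiv (ofSemidirect G) ofSemidirect_comp_toSemidirect
    toSemidirect_comp_ofSemidirect

end FPGroup

/-- `H(G)` is isomorphic to `(G * ℤ) ⋊ G` for the action in which `g` acts (on the
right) by the automorphism `s_g` fixing `G` and sending `t ↦ t g⁻¹`; as a left
action homomorphism this is `φ : g ↦ s_{g⁻¹}`. -/
theorem FPGroup_iso_semidirectProduct (G : Type*) [Group G] :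
    ∃ φ : G →* MulAut (FreeProdZ G),
      (∀ g : G, φ g = sAut g⁻¹) ∧
      Nonempty (FPGroup G ≃* SemidirectProduct (FreeProdZ G) G φ) :=
  ⟨sHom G, sHom_apply, ⟨FPGroup.equivSemidirect G⟩⟩
end

section
/- The group H(ℤ) is isomorphic to the one-relator group with presentation ⟨a, t | [a, [a, t]] = 1⟩, where [x,y] = x⁻¹y⁻¹xy. -/
/-!
STATEMENT 6: The Formanek–Procesi group `H(ℤ)` (for the infinite cyclic group `ℤ`)
is isomorphic to the one-relator group `⟨a, t | [a,[a,t]] = 1⟩`,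
where `[x,y] = x⁻¹y⁻¹xy`.
-/
variable (G : Type*) [Group G]

/-- The commutator convention of the paper: `[x,y] = x⁻¹ y⁻¹ x y`. -/
def pcomm {α : Type*} [Group α] (x y : α) : α := x⁻¹ * y⁻¹ * x * y

/-- The generator `a` of the free group on two generators `{a, t}`. -/
noncomputable def genA : FreeGroup Bool := FreeGroup.of false

/-- The generator `t` of the free group on two generators `{a, t}`. -/
noncomputable def genT : FreeGroup Bool := FreeGroup.of true

/-- The single relator `[a, [a, t]]`. -/
noncomputable def oneRel : Set (FreeGroup Bool) := {pcomm genA (pcomm genA genT)}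

theorem commute_iff_pcomm_eq_one {α : Type*} [Group α] (x y : α) :
    Commute x y ↔ pcomm x y = 1 := by
  rw [pcomm, mul_assoc, ← mul_inv_rev, inv_mul_eq_one, commute_iff_eq, eq_comm]

theorem mul_pcomm {α : Type*} [Group α] (x y : α) : x * pcomm x y = y⁻¹ * x * y := by
  simp [pcomm, mul_assoc]

theorem map_pcomm {α β : Type*} [Group α] [Group β] (f : α →* β) (x y : α) :
    f (pcomm x y) = pcomm (f x) (f y) := by
  simp [pcomm]

namespace FPGroup

/-- The image of `a` in the one-relator group. -/
noncomputable def relA : PresentedGroup oneRel := PresentedGroup.of false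

/-- The image of `t` in the one-relator group. -/
noncomputable def relT : PresentedGroup oneRel := PresentedGroup.of true

theorem commute_relA_pcomm : Commute relA (pcomm relA relT) := by
  rw [commute_iff_pcomm_eq_one]
  have h : PresentedGroup.mk oneRel (pcomm genA (pcomm genA genT)) = 1 :=
    PresentedGroup.one_of_mem rfl
  rwa [map_pcomm, map_pcomm] at h

/-- The homomorphism `ℤ × ℤ → ⟨a, t | [a,[a,t]]⟩` sending `(m, n)` to `a ^ m * [a,t] ^ n`. -/
noncomputable def baseHom :
    Multiplicative ℤ × Multiplicative ℤ →* PresentedGroup oneRel :=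
  (zpowersHom _ relA).noncommCoprod (zpowersHom _ (pcomm relA relT)) fun m n => by
    simpa using commute_relA_pcomm.zpow_zpow _ _

theorem baseHom_apply (p : Multiplicative ℤ × Multiplicative ℤ) :
    baseHom p = relA ^ p.1.toAdd * pcomm relA relT ^ p.2.toAdd := by
  simp [baseHom]

theorem relT_mul_baseHom (d : diagSubgroup (Multiplicative ℤ)) :
    relT * baseHom d = baseHom (diagToLeft (Multiplicative ℤ) d) * relT := by
  obtain ⟨⟨m, n⟩, h : m = n⟩ := d
  subst h
  have hconj : (relT⁻¹ * relA * relT) ^ m.toAdd = relT⁻¹ * relA ^ m.toAdd * relT := by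
    simpa using conj_zpow (i := m.toAdd) (a := relT⁻¹) (b := relA)
  simp only [baseHom_apply, diagToLeft, MulEquiv.coe_mk, Equiv.coe_fn_mk, toAdd_one, zpow_zero,
    mul_one]
  rw [← commute_relA_pcomm.mul_zpow, mul_pcomm, hconj]
  group

/-- The homomorphism `H(ℤ) → ⟨a, t | [a,[a,t]]⟩` sending `(1, 0)` to `a`, `(0, 1)` to `[a,t]`
and `t` to `t`. -/
noncomputable def toOneRelator :
    HNNExtension (Multiplicative ℤ × Multiplicative ℤ) (diagSubgroup _) (leftSubgroup _)
      (diagToLeft _) →* PresentedGroup oneRel :=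
  HNNExtension.lift baseHom relT relT_mul_baseHom

variable {G}

theorem pcomm_of_t (g : G) :
    pcomm (HNNExtension.of (g, 1)) HNNExtension.t =
      (HNNExtension.of (1, g) : HNNExtension (G × G) (diagSubgroup G) (leftSubgroup G)
        (diagToLeft G)) := by
  have h := HNNExtension.equiv_eq_conj (φ := diagToLeft G) ⟨(g, g), rfl⟩
  replace h : (HNNExtension.of (g, 1) : HNNExtension (G × G) (diagSubgroup G) (leftSubgroup G)
      (diagToLeft G)) = HNNExtension.t * HNNExtension.of (g, g) * HNNExtension.t⁻¹ := h
  have hmul : (HNNExtension.of (g, g) : HNNExtension (G × G) (diagSubgroup G) (leftSubgroup G)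
      (diagToLeft G)) = HNNExtension.of (g, 1) * HNNExtension.of (1, g) := by
    rw [← map_mul]; simp
  rw [← mul_right_inj (HNNExtension.of (g, 1)), mul_pcomm, ← hmul]
  rw [h]
  group

/-- The generators of `H(ℤ)` corresponding to `a` and `t`. -/
def generator : Bool → HNNExtension (Multiplicative ℤ × Multiplicative ℤ) (diagSubgroup _)
    (leftSubgroup _) (diagToLeft _)
  | false => HNNExtension.of (Multiplicative.ofAdd 1, 1)
  | true => HNNExtension.t

theorem lift_generator_eq_one : ∀ r ∈ oneRel, FreeGroup.lift generator r = 1 := by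
  rintro _ rfl
  rw [map_pcomm, map_pcomm, genA, genT, FreeGroup.lift_apply_of, FreeGroup.lift_apply_of,
    generator, generator, pcomm_of_t, ← commute_iff_pcomm_eq_one, commute_iff_eq, ← map_mul,
    ← map_mul, mul_comm]

/-- The homomorphism `⟨a, t | [a,[a,t]]⟩ → H(ℤ)` sending `a` to `(1, 0)` and `t` to `t`. -/
def ofOneRelator : PresentedGroup oneRel →*
    HNNExtension (Multiplicative ℤ × Multiplicative ℤ) (diagSubgroup _) (leftSubgroup _)
      (diagToLeft _) :=
  PresentedGroup.toGroup lift_generator_eq_one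

theorem ofOneRelator_relA :
    ofOneRelator relA = HNNExtension.of (Multiplicative.ofAdd 1, 1) :=
  PresentedGroup.toGroup.of lift_generator_eq_one

theorem ofOneRelator_relT : ofOneRelator relT = HNNExtension.t :=
  PresentedGroup.toGroup.of lift_generator_eq_one

theorem ofOneRelator_comp_toOneRelator :
    ofOneRelator.comp toOneRelator = MonoidHom.id _ := by
  refine HNNExtension.hom_ext ?_ ?_
  · ext p
    simp only [MonoidHom.comp_apply, MonoidHom.id_apply, toOneRelator, HNNExtension.lift_of,
      baseHom_apply, map_mul, map_zpow, map_pcomm, ofOneRelator_relA, ofOneRelator_relT,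
      pcomm_of_t]
    rw [← map_zpow, ← map_zpow, ← map_mul]
    congr 1
    ext <;> simp
  · simp [toOneRelator, ofOneRelator_relT]

theorem toOneRelator_comp_ofOneRelator :
    toOneRelator.comp ofOneRelator = MonoidHom.id _ := by
  refine PresentedGroup.ext fun b => ?_
  cases b
  · change toOneRelator (ofOneRelator relA) = relA
    simp [ofOneRelator_relA, toOneRelator, baseHom_apply]
  · change toOneRelator (ofOneRelator relT) = relT
    simp [ofOneRelator_relT, toOneRelator]

end FPGroup

/-- `H(ℤ)` is isomorphic to the one-relator group `⟨a, t | [a,[a,t]] = 1⟩`. -/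
theorem FPGroup_int_iso_one_relator :
    Nonempty (FPGroup (Multiplicative ℤ) ≃* PresentedGroup oneRel) := by
  exact ⟨MonoidHom.toMulEquiv FPGroup.toOneRelator FPGroup.ofOneRelator
    FPGroup.ofOneRelator_comp_toOneRelator FPGroup.toOneRelator_comp_ofOneRelator⟩
end
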